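/- Let β > 0, m > 0 and x ∈ ℝ³. The function G(z) = ∫_{ℝ³} e^{i⟨p,x⟩} · (1/(2w(p))) · ( e^{-i w(p) z}/(1 - e^{-β w(p)}) + e^{i w(p) z}/(e^{β w(p)} - 1) ) dp is holomorphic (complex differentiable) on the open strip { z ∈ ℂ : -β < Im z < 0 }. -/

import Mathlib

open MeasureTheory

/-- The analytic continuation `Δ^β_+(z, x)` (up to `(2π)^{-3}`) of the thermal two-point
function of the free KMS state at inverse temperature `β` to complex times `z`. -/
noncomputable def thermalG (β m : ℝ) (x : EuclideanSpace ℝ (Fin 3)) (z : ℂ) : ℂ :=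
  ∫ p : EuclideanSpace ℝ (Fin 3),
    Complex.exp (Complex.I * ((inner ℝ p x : ℝ) : ℂ)) *
      (1 / (2 * (Real.sqrt (‖p‖ ^ 2 + m ^ 2) : ℂ))) *
      (Complex.exp (-Complex.I * (Real.sqrt (‖p‖ ^ 2 + m ^ 2) : ℂ) * z) /
          (1 - Complex.exp (-(β : ℂ) * (Real.sqrt (‖p‖ ^ 2 + m ^ 2) : ℂ))) +
        Complex.exp (Complex.I * (Real.sqrt (‖p‖ ^ 2 + m ^ 2) : ℂ) * z) /
          (Complex.exp ((β : ℂ) * (Real.sqrt (‖p‖ ^ 2 + m ^ 2) : ℂ)) - 1))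

/-- The one-mode thermal factor with signs: `s = 1` gives the bracket in the integrand of
`thermalG`, and `s = -1` gives its `z`-derivative up to the factor `-i w`. -/
noncomputable def thermalMode (β s w : ℝ) (z : ℂ) : ℂ :=
  Complex.exp (-Complex.I * (w : ℂ) * z) / (1 - Complex.exp (-(β : ℂ) * (w : ℂ))) +
    (s : ℂ) * (Complex.exp (Complex.I * (w : ℂ) * z) / (Complex.exp ((β : ℂ) * (w : ℂ)) - 1))

theorem hasDerivAt_thermalMode (β w : ℝ) (z : ℂ) :
    HasDerivAt (thermalMode β 1 w) (-Complex.I * w * thermalMode β (-1) w z) z := by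
  have h (c : ℂ) : HasDerivAt (fun z => Complex.exp (c * z)) (Complex.exp (c * z) * c) z := by
    simpa using ((hasDerivAt_id z).const_mul c).cexp
  have h₁ := (h (-Complex.I * w)).div_const (1 - Complex.exp (-(β : ℂ) * w))
  have h₂ := ((h (Complex.I * w)).div_const (Complex.exp ((β : ℂ) * w) - 1)).const_mul ((1 : ℝ) : ℂ)
  refine (h₁.add h₂).congr_deriv ?_
  simp only [thermalMode]
  push_cast
  ring

theorem norm_thermalMode_le {β m w a s : ℝ} {z : ℂ} (hβ : 0 < β) (hm : 0 < m) (hw : m ≤ w)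
    (hs : |s| = 1) (hz₁ : a - β ≤ z.im) (hz₂ : z.im ≤ -a) :
    ‖thermalMode β s w z‖ ≤ 2 / (1 - Real.exp (-β * m)) * Real.exp (-a * w) := by
  have hw₀ : 0 < w := hm.trans_le hw
  have hc : 0 < 1 - Real.exp (-β * m) := by
    have : Real.exp (-β * m) < 1 := Real.exp_lt_one_iff.mpr (by nlinarith)
    linarith
  have hcw : 1 - Real.exp (-β * m) ≤ 1 - Real.exp (-β * w) := by
    have : Real.exp (-β * w) ≤ Real.exp (-β * m) := Real.exp_le_exp.mpr (by nlinarith)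
    linarith
  have hd₁ : ‖(1 : ℂ) - Complex.exp (-(β : ℂ) * w)‖ = 1 - Real.exp (-β * w) := by
    rw [← Complex.norm_of_nonneg (hc.le.trans hcw)]
    push_cast
    rfl
  have hsplit : Real.exp (β * w) - 1 = Real.exp (β * w) * (1 - Real.exp (-β * w)) := by
    rw [mul_sub, ← Real.exp_add]
    simp
  have hd₂ : ‖Complex.exp ((β : ℂ) * w) - 1‖ = Real.exp (β * w) * (1 - Real.exp (-β * w)) := by
    rw [← hsplit, ← Complex.norm_of_nonneg (r := Real.exp (β * w) - 1)]
    · push_cast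
      rfl
    · rw [hsplit]
      exact mul_nonneg (Real.exp_pos _).le (hc.le.trans hcw)
  have h₁ : ‖Complex.exp (-Complex.I * w * z) / (1 - Complex.exp (-(β : ℂ) * w))‖ ≤
      Real.exp (-a * w) / (1 - Real.exp (-β * m)) := by
    rw [norm_div, hd₁, Complex.norm_exp]
    gcongr
    simp
    nlinarith
  have h₂ : ‖Complex.exp (Complex.I * w * z) / (Complex.exp ((β : ℂ) * w) - 1)‖ ≤
      Real.exp (-a * w) / (1 - Real.exp (-β * m)) := by
    rw [norm_div, hd₂, Complex.norm_exp, ← div_div, ← Real.exp_sub]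
    gcongr
    simp
    nlinarith
  calc ‖thermalMode β s w z‖ ≤ _ := norm_add_le _ _
    _ ≤ Real.exp (-a * w) / (1 - Real.exp (-β * m)) +
        Real.exp (-a * w) / (1 - Real.exp (-β * m)) := by
      rw [norm_mul, Complex.norm_real, Real.norm_eq_abs, hs, one_mul]
      exact add_le_add h₁ h₂
    _ = _ := by ring

theorem integrable_exp_neg_mul_norm {E : Type*} [NormedAddCommGroup E] [NormedSpace ℝ E]
    [FiniteDimensional ℝ E] [Nontrivial E] [MeasurableSpace E] [BorelSpace E] (μ : Measure E)
    [μ.IsAddHaarMeasure] {a : ℝ} (ha : 0 < a) :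
    Integrable (fun p : E => Real.exp (-a * ‖p‖)) μ := by
  rw [integrable_fun_norm_addHaar μ (f := fun t => Real.exp (-a * t))]
  have h := integrableOn_rpow_mul_exp_neg_mul_rpow (p := 1)
    (s := ((Module.finrank ℝ E - 1 : ℕ) : ℝ))
    (neg_one_lt_zero.trans_le (Nat.cast_nonneg _)) one_pos ha
  simpa using h

/-- the thermal two-point function `G` is holomorphic on the open strip
`-β < Im z < 0`. -/
theorem thermalG_differentiableOn (β m : ℝ) (hβ : 0 < β) (hm : 0 < m)
    (x : EuclideanSpace ℝ (Fin 3)) :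
    DifferentiableOn ℂ (thermalG β m x) {z : ℂ | -β < z.im ∧ z.im < 0} := by
  rintro z₀ ⟨hz₁, hz₂⟩
  obtain ⟨a, ha, ha'⟩ := exists_between (lt_min (neg_pos.mpr hz₂) (neg_lt_iff_pos_add.mp hz₁))
  obtain ⟨ha₁, ha₂⟩ := lt_min_iff.mp ha'
  let w : EuclideanSpace ℝ (Fin 3) → ℝ := fun p => Real.sqrt (‖p‖ ^ 2 + m ^ 2)
  have hmw (p) : m ≤ w p := Real.le_sqrt_of_sq_le (by nlinarith [sq_nonneg ‖p‖])
  have hpw (p) : ‖p‖ ≤ w p := Real.le_sqrt_of_sq_le (by nlinarith [sq_nonneg m])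
  let K : EuclideanSpace ℝ (Fin 3) → ℂ := fun p =>
    Complex.exp (Complex.I * ((inner ℝ p x : ℝ) : ℂ)) * (1 / (2 * (w p : ℂ)))
  have hK (p) : ‖K p‖ = 1 / (2 * w p) := by
    have : 0 ≤ w p := hm.le.trans (hmw p)
    simp [K, Complex.norm_exp, abs_of_nonneg this]
  have hw_meas : Measurable w := by fun_prop
  have hK_meas : Measurable K := by fun_prop
  have hmode_meas (s : ℝ) (z : ℂ) : Measurable fun p => thermalMode β s (w p) z := by
    unfold thermalMode
    fun_prop
  have hG : thermalG β m x = fun z => ∫ p, K p * thermalMode β 1 (w p) z := by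
    ext z
    simp [thermalG, thermalMode, K, w]
  let C : ℝ := 2 / (1 - Real.exp (-β * m))
  have hC : 0 ≤ C := by
    have : Real.exp (-β * m) < 1 := Real.exp_lt_one_iff.mpr (by nlinarith)
    exact div_nonneg zero_le_two (by linarith)
  have hmode {s : ℝ} (hs : |s| = 1) {z : ℂ} (h₁ : a - β < z.im) (h₂ : z.im < -a) (p) :
      ‖thermalMode β s (w p) z‖ ≤ C * Real.exp (-a * ‖p‖) := by
    refine (norm_thermalMode_le hβ hm (hmw p) hs h₁.le h₂.le).trans ?_
    refine mul_le_mul_of_nonneg_left (Real.exp_le_exp.mpr ?_) hC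
    nlinarith [hpw p]
  have hexp : Integrable fun p : EuclideanSpace ℝ (Fin 3) => Real.exp (-a * ‖p‖) :=
    integrable_exp_neg_mul_norm volume ha
  let S : Set ℂ := {z | a - β < z.im ∧ z.im < -a}
  have hS : S ∈ nhds z₀ :=
    ((isOpen_lt continuous_const Complex.continuous_im).inter
      (isOpen_lt Complex.continuous_im continuous_const)).mem_nhds
      ⟨show a - β < z₀.im by linarith, show z₀.im < -a by linarith⟩
  have hz₀ : z₀ ∈ S := mem_of_mem_nhds hS
  rw [hG]
  refine (hasDerivAt_integral_of_dominated_loc_of_deriv_le (s := S)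
    (F' := fun z p => K p * (-Complex.I * w p * thermalMode β (-1) (w p) z))
    (bound := fun p => 1 / 2 * (C * Real.exp (-a * ‖p‖))) hS
    (.of_forall fun z => (hK_meas.mul (hmode_meas 1 z)).aestronglyMeasurable) ?_ ?_ ?_
    ((hexp.const_mul C).const_mul _) ?_).2.differentiableAt.differentiableWithinAt
  · refine ((hexp.const_mul C).const_mul (1 / (2 * m))).mono'
      (hK_meas.mul (hmode_meas 1 z₀)).aestronglyMeasurable (.of_forall fun p => ?_)
    rw [Pi.mul_apply, norm_mul, hK]
    gcongr
    · exact hmw p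
    · exact hmode (by simp) hz₀.1 hz₀.2 p
  · have := hmode_meas (-1) z₀
    exact Measurable.aestronglyMeasurable (by fun_prop)
  · refine .of_forall fun p z hz => ?_
    have hw : 0 < w p := hm.trans_le (hmw p)
    have hKw : ‖K p‖ * ‖-Complex.I * (w p : ℂ)‖ = 1 / 2 := by
      rw [hK]
      simp [abs_of_pos hw]
      field_simp
    rw [norm_mul (K p), norm_mul _ (thermalMode _ _ _ _), ← mul_assoc, hKw]
    gcongr
    exact hmode (by simp) hz.1 hz.2 p
  · exact .of_forall fun p z _ => (hasDerivAt_thermalMode β (w p) z).const_mul (K p)
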